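/- Theorem 3.2 (perturbed left-hand side). Let n, k be positive integers, A ∈ ℝ^{n×n}, x⁰, …, x^k ∈ ℝⁿ, r^k ∈ ℝⁿ, and E_1, …, E_k ∈ ℝ^{n×n}. Let R_k ∈ ℝ^{n×k} be arbitrary, let ℰ_k ∈ ℝ^{n×k} be the matrix whose i-th column is E_i A (x^i − x^{i−1}), and set R̂_k = R_k + ℰ_k. Suppose R̂_k has a QR factorization R̂_k = Q̂T̂ with Q̂ᵀQ̂ = I_k and T̂ invertible, and let ĝ ∈ ℝ^k be a least-squares solution of min_g ‖R̂_k g − r^k‖₂. Let ε > 0. If for every i = 1, …, k the bound k · ‖T̂⁻¹‖₂ · ‖E_i‖₂ · ‖r^k‖₂ · ‖x^i − x^{i−1}‖₂ ≤ ε holds, then the backward error satisfies δ_k := ‖ℰ_k ĝ‖₂ ≤ ε ‖A‖₂. -/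

import Mathlib

open Matrix

noncomputable def vnorm {n : ℕ} (v : Fin n → ℝ) : ℝ :=
  ‖(WithLp.equiv 2 (Fin n → ℝ)).symm v‖

noncomputable def mnorm {m n : ℕ} (M : Matrix (Fin m) (Fin n) ℝ) : ℝ :=
  ‖LinearMap.toContinuousLinearMap (Matrix.toEuclideanLin M)‖

def IsLSSol {n k : ℕ} (M : Matrix (Fin n) (Fin k) ℝ) (r : Fin n → ℝ)
    (g : Fin k → ℝ) : Prop :=
  ∀ h : Fin k → ℝ, vnorm (M.mulVec g - r) ≤ vnorm (M.mulVec h - r)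

lemma vnorm_eq_norm_toLp {n : ℕ} (v : Fin n → ℝ) : vnorm v = ‖WithLp.toLp 2 v‖ := rfl

lemma vnorm_nonneg {n : ℕ} (v : Fin n → ℝ) : 0 ≤ vnorm v := norm_nonneg _

lemma mnorm_nonneg {m n : ℕ} (M : Matrix (Fin m) (Fin n) ℝ) : 0 ≤ mnorm M := norm_nonneg _

lemma vnorm_sq {n : ℕ} (v : Fin n → ℝ) : vnorm v ^ 2 = v ⬝ᵥ v := by
  rw [vnorm_eq_norm_toLp, EuclideanSpace.real_norm_sq_eq]
  simp [dotProduct, sq]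

lemma vnorm_smul {n : ℕ} (c : ℝ) (v : Fin n → ℝ) : vnorm (c • v) = |c| * vnorm v := by
  rw [vnorm_eq_norm_toLp, vnorm_eq_norm_toLp, WithLp.toLp_smul, norm_smul, Real.norm_eq_abs]

lemma vnorm_sum_le {ι : Type*} {n : ℕ} (s : Finset ι) (f : ι → Fin n → ℝ) :
    vnorm (∑ j ∈ s, f j) ≤ ∑ j ∈ s, vnorm (f j) := by
  simp only [vnorm_eq_norm_toLp, WithLp.toLp_sum]
  exact norm_sum_le _ _

lemma abs_apply_le_vnorm {n : ℕ} (v : Fin n → ℝ) (i : Fin n) : |v i| ≤ vnorm v :=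
  PiLp.norm_apply_le (WithLp.toLp 2 v) i

lemma vnorm_mulVec_le {m n : ℕ} (M : Matrix (Fin m) (Fin n) ℝ) (v : Fin n → ℝ) :
    vnorm (M *ᵥ v) ≤ mnorm M * vnorm v :=
  (LinearMap.toContinuousLinearMap (Matrix.toEuclideanLin M)).le_opNorm (WithLp.toLp 2 v)

lemma vnorm_mulVec_of_transpose_mul_self {m n : ℕ} {Q : Matrix (Fin m) (Fin n) ℝ}
    (hQ : Qᵀ * Q = 1) (v : Fin n → ℝ) : vnorm (Q *ᵥ v) = vnorm v := by
  rw [← sq_eq_sq₀ (vnorm_nonneg _) (vnorm_nonneg _), vnorm_sq, vnorm_sq,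
    dotProduct_mulVec, vecMul_mulVec, hQ, ← dotProduct_mulVec, one_mulVec]

lemma norm_le_of_forall_norm_sub_le {F : Type*} [NormedAddCommGroup F] [InnerProductSpace ℝ F]
    {u r : F} (h : ∀ t : ℝ, ‖u - r‖ ≤ ‖t • u - r‖) : ‖u‖ ≤ ‖r‖ := by
  rcases eq_or_ne u 0 with rfl | hu
  · simp
  have hpos : 0 < ‖u‖ := norm_pos_iff.mpr hu
  have hquad (t : ℝ) :
      ‖u‖ ^ 2 - 2 * inner ℝ u r ≤ t ^ 2 * ‖u‖ ^ 2 - 2 * (t * inner ℝ u r) := by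
    have h2 := pow_le_pow_left₀ (norm_nonneg _) (h t) 2
    rw [norm_sub_sq_real, norm_sub_sq_real, inner_smul_left, norm_smul, mul_pow,
      Real.norm_eq_abs, sq_abs] at h2
    simp only [conj_trivial] at h2
    linarith
  have ht := hquad (inner ℝ u r / ‖u‖ ^ 2)
  have hsq : (‖u‖ ^ 2 - inner ℝ u r) ^ 2 ≤ 0 := by
    field_simp at ht
    nlinarith
  have heq : ‖u‖ ^ 2 = inner ℝ u r := by nlinarith
  have hcs := real_inner_le_norm u r
  nlinarith

lemma IsLSSol.vnorm_mulVec_le {n k : ℕ} {M : Matrix (Fin n) (Fin k) ℝ} {r : Fin n → ℝ}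
    {g : Fin k → ℝ} (hg : IsLSSol M r g) : vnorm (M *ᵥ g) ≤ vnorm r := by
  refine norm_le_of_forall_norm_sub_le fun t => ?_
  have h := hg (t • g)
  rw [mulVec_smul] at h
  exact h

lemma IsLSSol.vnorm_le_of_qr {n k : ℕ} {Q : Matrix (Fin n) (Fin k) ℝ}
    {T : Matrix (Fin k) (Fin k) ℝ} {r : Fin n → ℝ} {g : Fin k → ℝ}
    (hg : IsLSSol (Q * T) r g) (hQ : Qᵀ * Q = 1) (hT : IsUnit T) :
    vnorm g ≤ mnorm T⁻¹ * vnorm r := by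
  have hTg : vnorm (T *ᵥ g) ≤ vnorm r := by
    rw [← vnorm_mulVec_of_transpose_mul_self hQ, mulVec_mulVec]
    exact hg.vnorm_mulVec_le
  calc vnorm g = vnorm (T⁻¹ *ᵥ (T *ᵥ g)) := by
        rw [mulVec_mulVec, nonsing_inv_mul _ ((isUnit_iff_isUnit_det T).mp hT), one_mulVec]
    _ ≤ mnorm T⁻¹ * vnorm (T *ᵥ g) := _root_.vnorm_mulVec_le _ _
    _ ≤ mnorm T⁻¹ * vnorm r := mul_le_mul_of_nonneg_left hTg (mnorm_nonneg _)

/-- Theorem 3.2: backward error bound with perturbed left-hand side. -/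
theorem theorem_3_2 {n k : ℕ} (hn : 0 < n) (hk : 0 < k)
    (A : Matrix (Fin n) (Fin n) ℝ) (x : ℕ → Fin n → ℝ) (rk : Fin n → ℝ)
    (E : Fin k → Matrix (Fin n) (Fin n) ℝ)
    (Rk Ecal : Matrix (Fin n) (Fin k) ℝ)
    (hE : ∀ j : Fin k,
      (fun i => Ecal i j) = (E j).mulVec (A.mulVec (x ((j : ℕ) + 1) - x (j : ℕ))))
    (Rhat : Matrix (Fin n) (Fin k) ℝ) (hRhat : Rhat = Rk + Ecal)
    (Qhat : Matrix (Fin n) (Fin k) ℝ) (That : Matrix (Fin k) (Fin k) ℝ)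
    (hQR : Rhat = Qhat * That) (hQ : Qhatᵀ * Qhat = 1) (hT : IsUnit That)
    (ghat : Fin k → ℝ) (hg : IsLSSol Rhat rk ghat)
    (ε : ℝ) (hε : 0 < ε)
    (hbound : ∀ j : Fin k,
      (k : ℝ) * mnorm That⁻¹ * mnorm (E j) * vnorm rk *
        vnorm (x ((j : ℕ) + 1) - x (j : ℕ)) ≤ ε) :
    vnorm (Ecal.mulVec ghat) ≤ ε * mnorm A := by
  subst hQR
  have hgnorm := hg.vnorm_le_of_qr hQ hT
  have hk' : (0 : ℝ) < k := by exact_mod_cast hk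
  have hsum : Ecal *ᵥ ghat = ∑ j, ghat j • fun i => Ecal i j := by
    ext i
    simp [mulVec, dotProduct, mul_comm]
  have hterm (j : Fin k) : vnorm (ghat j • fun i => Ecal i j) ≤ ε * mnorm A / k := by
    rw [vnorm_smul, hE j, le_div_iff₀ hk']
    set d := x ((j : ℕ) + 1) - x (j : ℕ)
    have hcol : vnorm (E j *ᵥ (A *ᵥ d)) ≤ mnorm (E j) * (mnorm A * vnorm d) :=
      (vnorm_mulVec_le _ _).trans
        (mul_le_mul_of_nonneg_left (vnorm_mulVec_le _ _) (mnorm_nonneg _))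
    calc |ghat j| * vnorm (E j *ᵥ (A *ᵥ d)) * k
        ≤ (mnorm That⁻¹ * vnorm rk) * (mnorm (E j) * (mnorm A * vnorm d)) * k := by
          refine mul_le_mul_of_nonneg_right (mul_le_mul
            ((abs_apply_le_vnorm _ _).trans hgnorm) hcol (vnorm_nonneg _) ?_) hk'.le
          exact mul_nonneg (mnorm_nonneg _) (vnorm_nonneg _)
      _ = (k * mnorm That⁻¹ * mnorm (E j) * vnorm rk * vnorm d) * mnorm A := by ring
      _ ≤ ε * mnorm A := mul_le_mul_of_nonneg_right (hbound j) (mnorm_nonneg _)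
  calc vnorm (Ecal *ᵥ ghat) ≤ ∑ j, vnorm (ghat j • fun i => Ecal i j) := by
        rw [hsum]
        exact vnorm_sum_le _ _
    _ ≤ ∑ _j : Fin k, ε * mnorm A / k := Finset.sum_le_sum fun j _ => hterm j
    _ = ε * mnorm A := by
        rw [Finset.sum_const, Finset.card_univ, Fintype.card_fin, nsmul_eq_mul]
        field_simp
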